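/- arXiv:2311.11934 — 7 statements merged into one kernel-verified Lean document; each statement's English description precedes it below -/
import Mathlib

section
/- Let X be a random vector in ℝᵈ and σ > 0 such that E[exp(‖X‖²/(2dσ²))] ≤ 2, and let f : ℝᵈ → ℝ be a 1-Lipschitz function (with respect to the Euclidean distance) satisfying E[f(X)] = 0. Then E[exp(f(X)²/(8dσ²))] ≤ 2. (Lemma 7 in the supplement.) -/
open MeasureTheory

/-- The square of the mean is at most the second moment. -/
lemma sq_integral_le_integral_sq {Ω : Type*} [MeasurableSpace Ω] {μ : Measure Ω}
    [IsProbabilityMeasure μ] {Y : Ω → ℝ} (hY : MemLp Y 2 μ) :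
    (∫ ω, Y ω ∂μ) ^ 2 ≤ ∫ ω, Y ω ^ 2 ∂μ := by
  have h := ProbabilityTheory.variance_nonneg Y μ
  rw [ProbabilityTheory.variance_eq_sub hY] at h
  simpa using h

/-- A 1-Lipschitz function with mean zero under the law of `X` is bounded by `‖x‖ + E‖X‖`. -/
lemma LipschitzWith.abs_le_norm_add_integral_norm {Ω E : Type*} [MeasurableSpace Ω]
    {μ : Measure Ω} [IsProbabilityMeasure μ] [NormedAddCommGroup E] {X : Ω → E} {f : E → ℝ}
    (hf : LipschitzWith 1 f) (hX : Integrable X μ) (hmean : ∫ ω, f (X ω) ∂μ = 0) (x : E) :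
    |f x| ≤ ‖x‖ + ∫ ω, ‖X ω‖ ∂μ := by
  have hlip : ∀ y z, |f y - f z| ≤ ‖y‖ + ‖z‖ := fun y z ↦ by
    have h := hf.dist_le_mul y z
    rw [Real.dist_eq, NNReal.coe_one, one_mul, dist_eq_norm] at h
    exact h.trans (_root_.norm_sub_le y z)
  have hbound : Integrable (fun ω ↦ ‖x‖ + ‖X ω‖) μ := (integrable_const _).add hX.norm
  have hdiff : Integrable (fun ω ↦ f x - f (X ω)) μ :=
    hbound.mono' (aestronglyMeasurable_const.sub
      (hf.continuous.comp_aestronglyMeasurable hX.aestronglyMeasurable))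
      (.of_forall fun ω ↦ hlip x (X ω))
  have hfX : Integrable (fun ω ↦ f (X ω)) μ := by
    refine ((integrable_const (f x)).sub hdiff).congr (.of_forall fun ω ↦ ?_)
    simp
  have heq : f x = ∫ ω, (f x - f (X ω)) ∂μ := by
    rw [integral_sub (integrable_const _) hfX, hmean]
    simp
  calc |f x| = |∫ ω, (f x - f (X ω)) ∂μ| := by rw [← heq]
    _ ≤ ∫ ω, |f x - f (X ω)| ∂μ := abs_integral_le_integral_abs
    _ ≤ ∫ ω, (‖x‖ + ‖X ω‖) ∂μ := integral_mono hdiff.abs hbound fun ω ↦ hlip x (X ω)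
    _ = ‖x‖ + ∫ ω, ‖X ω‖ ∂μ := by
      rw [integral_add (integrable_const _) hX.norm]
      simp

/-- If `E[exp(2‖X‖²/c)] ≤ 2` and `f` is 1-Lipschitz with `E[f(X)] = 0`, then
`E[exp(f(X)²/(2c))] ≤ 2`. -/
lemma LipschitzWith.lintegral_exp_sq_le_two {Ω E : Type*} [MeasurableSpace Ω]
    {μ : Measure Ω} [IsProbabilityMeasure μ] [NormedAddCommGroup E] {X : Ω → E} {f : E → ℝ}
    {c : ℝ} (hc : 0 < c) (hX : AEStronglyMeasurable X μ)
    (hsubg : ∫⁻ ω, ENNReal.ofReal (Real.exp (2 * (‖X ω‖ ^ 2 / c))) ∂μ ≤ 2)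
    (hf : LipschitzWith 1 f) (hmean : ∫ ω, f (X ω) ∂μ = 0) :
    ∫⁻ ω, ENNReal.ofReal (Real.exp (f (X ω) ^ 2 / (2 * c))) ∂μ ≤ 2 := by
  set Z : Ω → ℝ := fun ω ↦ ‖X ω‖ ^ 2 / c with hZdef
  have hZm : AEStronglyMeasurable Z μ :=
    (hX.norm.aemeasurable.pow_const 2 |>.div_const c).aestronglyMeasurable
  have hum : AEStronglyMeasurable (fun ω ↦ Real.exp (Z ω)) μ :=
    Real.continuous_exp.comp_aestronglyMeasurable hZm
  have hsq : ∀ ω, Real.exp (2 * Z ω) = Real.exp (Z ω) ^ 2 := fun ω ↦ by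
    rw [← Real.exp_nat_mul]
    norm_num
  have hu2 : Integrable (fun ω ↦ Real.exp (Z ω) ^ 2) μ := by
    simp_rw [← hsq]
    refine ⟨Real.continuous_exp.comp_aestronglyMeasurable (hZm.const_mul 2), ?_⟩
    rw [hasFiniteIntegral_iff_ofReal (.of_forall fun ω ↦ (Real.exp_pos _).le)]
    exact hsubg.trans_lt (by norm_num)
  have huL2 : MemLp (fun ω ↦ Real.exp (Z ω)) 2 μ := (memLp_two_iff_integrable_sq hum).2 hu2
  have hu : Integrable (fun ω ↦ Real.exp (Z ω)) μ := huL2.integrable one_le_two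
  have hZ0 : ∀ ω, 0 ≤ Z ω := fun ω ↦ by positivity
  have hZ : Integrable Z μ := hu.mono' hZm (.of_forall fun ω ↦ by
    rw [Real.norm_of_nonneg (hZ0 ω)]
    linarith [Real.add_one_le_exp (Z ω)])
  have hXL2 : MemLp (fun ω ↦ ‖X ω‖) 2 μ := by
    refine (memLp_two_iff_integrable_sq hX.norm).2 ((hZ.mul_const c).congr (.of_forall fun ω ↦ ?_))
    simp only [hZdef]
    field_simp
  have hXint : Integrable X μ :=
    (integrable_norm_iff hX).1 (hXL2.integrable one_le_two)
  set m := ∫ ω, ‖X ω‖ ∂μ with hm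
  set A := ∫ ω, Real.exp (Z ω) ∂μ with hA
  have hA2 : A ^ 2 ≤ 2 := by
    refine (sq_integral_le_integral_sq huL2).trans ?_
    simp_rw [← hsq] at hu2 ⊢
    rw [← ofReal_integral_eq_lintegral_ofReal hu2 (.of_forall fun ω ↦ (Real.exp_pos _).le)]
      at hsubg
    exact (ENNReal.ofReal_le_ofReal_iff zero_le_two).1 (by simpa using hsubg)
  have hA0 : 0 ≤ A := integral_nonneg fun ω ↦ (Real.exp_pos _).le
  have hmA : Real.exp (m ^ 2 / c) ≤ A := by
    have hm2 : m ^ 2 / c ≤ ∫ ω, Z ω ∂μ := by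
      rw [hZdef, integral_div]
      gcongr
      exact sq_integral_le_integral_sq hXL2
    exact (Real.exp_le_exp.2 hm2).trans <|
      convexOn_exp.map_integral_le Real.continuous_exp.continuousOn isClosed_univ
        (.of_forall fun _ ↦ Set.mem_univ _) hZ hu
  have hpt : ∀ ω, Real.exp (f (X ω) ^ 2 / (2 * c)) ≤ A * Real.exp (Z ω) := fun ω ↦ by
    have h := hf.abs_le_norm_add_integral_norm hXint hmean (X ω)
    have h2 : f (X ω) ^ 2 ≤ (‖X ω‖ + m) ^ 2 := sq_le_sq' (by linarith [neg_abs_le (f (X ω))])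
      ((le_abs_self _).trans h)
    have h3 : f (X ω) ^ 2 / (2 * c) ≤ m ^ 2 / c + Z ω := by
      rw [hZdef, ← add_div, div_le_div_iff₀ (by positivity) hc]
      nlinarith [sq_nonneg (‖X ω‖ - m)]
    calc Real.exp (f (X ω) ^ 2 / (2 * c)) ≤ Real.exp (m ^ 2 / c + Z ω) := Real.exp_le_exp.2 h3
      _ = Real.exp (m ^ 2 / c) * Real.exp (Z ω) := Real.exp_add _ _
      _ ≤ A * Real.exp (Z ω) := by gcongr
  calc ∫⁻ ω, ENNReal.ofReal (Real.exp (f (X ω) ^ 2 / (2 * c))) ∂μ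
      ≤ ∫⁻ ω, ENNReal.ofReal (A * Real.exp (Z ω)) ∂μ :=
        lintegral_mono fun ω ↦ ENNReal.ofReal_le_ofReal (hpt ω)
    _ = ENNReal.ofReal (∫ ω, A * Real.exp (Z ω) ∂μ) :=
        (ofReal_integral_eq_lintegral_ofReal (hu.const_mul A)
          (.of_forall fun ω ↦ mul_nonneg hA0 (Real.exp_pos _).le)).symm
    _ = ENNReal.ofReal (A ^ 2) := by rw [integral_const_mul, ← hA, sq]
    _ ≤ ENNReal.ofReal 2 := ENNReal.ofReal_le_ofReal hA2
    _ = 2 := by simp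

/-- Lemma 7: if `X` is a `σ²`-norm-subGaussian random vector in `ℝᵈ` and `f` is a
1-Lipschitz function with `E[f(X)] = 0`, then `E[exp(f(X)²/(8dσ²))] ≤ 2`. -/
theorem lipschitz_sq_subGaussian_of_normSubGaussian
    {Ω : Type*} [MeasurableSpace Ω] (μ : Measure Ω) [IsProbabilityMeasure μ]
    (d : ℕ) (σ : ℝ) (hσ : 0 < σ)
    (X : Ω → EuclideanSpace ℝ (Fin d)) (hX : AEMeasurable X μ)
    (hsubg : ∫⁻ ω, ENNReal.ofReal (Real.exp (‖X ω‖ ^ 2 / (2 * d * σ ^ 2))) ∂μ ≤ 2)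
    (f : EuclideanSpace ℝ (Fin d) → ℝ) (hf : LipschitzWith 1 f)
    (hmean : ∫ ω, f (X ω) ∂μ = 0) :
    ∫⁻ ω, ENNReal.ofReal (Real.exp (f (X ω) ^ 2 / (8 * d * σ ^ 2))) ∂μ ≤ 2 := by
  rcases Nat.eq_zero_or_pos d with rfl | hd
  · simp
  · have hd' : (0 : ℝ) < d := Nat.cast_pos.2 hd
    have h := hf.lintegral_exp_sq_le_two (c := 4 * d * σ ^ 2) (by positivity)
      hX.aestronglyMeasurable
      (by
        convert hsubg using 5
        field_simp
        ring) hmean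
    convert h using 5
    ring
end

section
/- Let X be a random vector in ℝᵈ and σ > 0 such that E[exp(‖X‖²/(2dσ²))] ≤ 2. Then for every 1-Lipschitz function f : ℝᵈ → ℝ with E[f(X)] = 0 and for every λ ∈ ℝ, E[exp(λ·f(X))] ≤ exp(8·d·σ²·λ²). (Lemma 8: the Laplace functional of a σ²-norm-subGaussian measure satisfies E_μ(λ) ≤ exp(8dσ²λ²).) -/
open MeasureTheory

theorem Real.exp_le_add_exp_sq (x : ℝ) : Real.exp x ≤ x + Real.exp (x ^ 2) := by
  have hsq := Real.add_one_le_exp (x ^ 2)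
  rcases le_or_gt |x| 1 with hx | hx
  · have h := (abs_le.1 (Real.abs_exp_sub_one_sub_id_le hx)).2
    linarith
  · rcases lt_abs.1 hx with h | h
    · have : Real.exp x ≤ Real.exp (x ^ 2) := Real.exp_le_exp.2 (by nlinarith)
      linarith
    · have : Real.exp x ≤ 1 := Real.exp_le_one_iff.2 (by linarith)
      nlinarith

theorem Real.exp_mul_le_one_sub_add_mul_exp {p : ℝ} (hp : 0 ≤ p) (hp' : p ≤ 1) (s : ℝ) :
    Real.exp (p * s) ≤ 1 - p + p * Real.exp s := by
  have h := convexOn_exp.2 (Set.mem_univ 0) (Set.mem_univ s) (sub_nonneg.2 hp') hp (by ring)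
  simpa using h

/-- A domination principle turning a pointwise bound into a bound on a Lebesgue integral. -/
theorem lintegral_ofReal_le_ofReal_of_le {Ω : Type*} [MeasurableSpace Ω] {μ : Measure Ω}
    {F G : Ω → ℝ} {c : ℝ} (hG : Integrable G μ) (hF : ∀ ω, 0 ≤ F ω) (hFG : ∀ ω, F ω ≤ G ω)
    (hc : ∫ ω, G ω ∂μ ≤ c) :
    ∫⁻ ω, ENNReal.ofReal (F ω) ∂μ ≤ ENNReal.ofReal c := by
  calc ∫⁻ ω, ENNReal.ofReal (F ω) ∂μ ≤ ∫⁻ ω, ENNReal.ofReal (G ω) ∂μ :=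
        lintegral_mono fun ω => ENNReal.ofReal_le_ofReal (hFG ω)
    _ = ENNReal.ofReal (∫ ω, G ω ∂μ) :=
        (ofReal_integral_eq_lintegral_ofReal hG
          (Filter.Eventually.of_forall fun ω => (hF ω).trans (hFG ω))).symm
    _ ≤ ENNReal.ofReal c := ENNReal.ofReal_le_ofReal hc

/-- A centered variable `h` with `|h| ≤ 1 + t`, where `E[exp (t²)] ≤ 2`, is subGaussian. -/
theorem lintegral_exp_mul_le_of_abs_le_one_add {Ω : Type*} [MeasurableSpace Ω] {μ : Measure Ω}
    [IsProbabilityMeasure μ] {h t : Ω → ℝ} (hh : Integrable h μ) (h0 : ∫ ω, h ω ∂μ = 0)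
    (ht : Integrable (fun ω => Real.exp (t ω ^ 2)) μ) (ht2 : ∫ ω, Real.exp (t ω ^ 2) ∂μ ≤ 2)
    (hle : ∀ ω, |h ω| ≤ 1 + t ω) (a : ℝ) :
    ∫⁻ ω, ENNReal.ofReal (Real.exp (a * h ω)) ∂μ ≤ ENNReal.ofReal (Real.exp (4 * a ^ 2)) := by
  rcases le_or_gt (2 * a ^ 2) 1 with ha | ha
  · have hp : 0 ≤ 2 * a ^ 2 := by positivity
    have hint : Integrable (fun ω => (1 - 2 * a ^ 2) + 2 * a ^ 2 * Real.exp (t ω ^ 2)) μ :=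
      (integrable_const _).add (ht.const_mul _)
    refine lintegral_ofReal_le_ofReal_of_le
      (G := fun ω => a * h ω + Real.exp (2 * a ^ 2) *
        ((1 - 2 * a ^ 2) + 2 * a ^ 2 * Real.exp (t ω ^ 2)))
      ((hh.const_mul a).add (hint.const_mul _)) (fun ω => (Real.exp_pos _).le) (fun ω => ?_) ?_
    · refine (Real.exp_le_add_exp_sq _).trans ?_
      gcongr
      refine le_trans ?_ (mul_le_mul_of_nonneg_left
        (Real.exp_mul_le_one_sub_add_mul_exp hp ha (t ω ^ 2)) (Real.exp_pos _).le)
      rw [← Real.exp_add, Real.exp_le_exp]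
      have h1 : h ω ^ 2 ≤ (1 + t ω) ^ 2 := sq_le_sq' (abs_le.1 (hle ω)).1 (abs_le.1 (hle ω)).2
      have h2 : h ω ^ 2 ≤ 2 + 2 * t ω ^ 2 := by nlinarith [sq_nonneg (1 - t ω)]
      nlinarith [mul_le_mul_of_nonneg_left h2 (sq_nonneg a)]
    · rw [integral_add (hh.const_mul a) (hint.const_mul _), integral_const_mul,
        integral_const_mul, integral_add (integrable_const _) (ht.const_mul _),
        integral_const_mul, h0]
      simp only [integral_const, probReal_univ, smul_eq_mul, mul_zero, zero_add, one_mul]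
      rw [show 4 * a ^ 2 = 2 * a ^ 2 + 2 * a ^ 2 by ring, Real.exp_add (2 * a ^ 2)]
      gcongr
      nlinarith [Real.add_one_le_exp (2 * a ^ 2)]
  · refine lintegral_ofReal_le_ofReal_of_le
      (G := fun ω => Real.exp (|a| + a ^ 2 / 4) * Real.exp (t ω ^ 2))
      (ht.const_mul _) (fun ω => (Real.exp_pos _).le) (fun ω => ?_) ?_
    · rw [← Real.exp_add, Real.exp_le_exp]
      have h1 : a * h ω ≤ |a| * (1 + t ω) := (le_abs_self _).trans (by
        rw [abs_mul]
        exact mul_le_mul_of_nonneg_left (hle ω) (abs_nonneg a))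
      nlinarith [sq_nonneg (|a| / 2 - t ω), sq_abs a]
    · rw [integral_const_mul]
      have h2 : (2 : ℝ) ≤ Real.exp (2 * a ^ 2 * (7 / 10)) :=
        calc (2 : ℝ) = Real.exp (Real.log 2) := (Real.exp_log two_pos).symm
          _ ≤ _ := Real.exp_le_exp.2 (by linarith [Real.log_two_lt_d9])
      refine (mul_le_mul_of_nonneg_left (ht2.trans h2) (Real.exp_pos _).le).trans ?_
      rw [← Real.exp_add, Real.exp_le_exp]
      have h3 : 1 / 2 ≤ |a| := by
        by_contra! hlt
        nlinarith [sq_abs a, abs_nonneg a]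
      nlinarith [sq_abs a]

/-- Lemma 8: the Laplace functional of a `σ²`-norm-subGaussian measure on `ℝᵈ` satisfies
`E[exp(λ f(X))] ≤ exp(8 d σ² λ²)` for every 1-Lipschitz `f` with `E[f(X)] = 0` and all `λ`. -/
theorem laplace_functional_of_normSubGaussian
    {Ω : Type*} [MeasurableSpace Ω] (μ : Measure Ω) [IsProbabilityMeasure μ]
    (d : ℕ) (σ : ℝ) (hσ : 0 < σ)
    (X : Ω → EuclideanSpace ℝ (Fin d)) (hX : AEMeasurable X μ)
    (hsubg : ∫⁻ ω, ENNReal.ofReal (Real.exp (‖X ω‖ ^ 2 / (2 * d * σ ^ 2))) ∂μ ≤ 2) :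
    ∀ f : EuclideanSpace ℝ (Fin d) → ℝ, LipschitzWith 1 f →
      (∫ ω, f (X ω) ∂μ = 0) →
      ∀ l : ℝ, ∫⁻ ω, ENNReal.ofReal (Real.exp (l * f (X ω))) ∂μ
        ≤ ENNReal.ofReal (Real.exp (8 * d * σ ^ 2 * l ^ 2)) := by
  intro f hf hmean l
  rcases Nat.eq_zero_or_pos d with rfl | hd
  · have hconst : ∀ ω, f (X ω) = f 0 := fun ω => congrArg f (Subsingleton.elim _ _)
    simp only [hconst, integral_const, probReal_univ, smul_eq_mul, one_mul] at hmean
    simp [hconst, hmean]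
  have hdpos : (0 : ℝ) < d := Nat.cast_pos.2 hd
  obtain ⟨c, hc, hc2⟩ : ∃ c : ℝ, 0 < c ∧ c ^ 2 = 2 * d * σ ^ 2 :=
    ⟨√(2 * d * σ ^ 2), by positivity, Real.sq_sqrt (by positivity)⟩
  have hcne : c ≠ 0 := hc.ne'
  simp only [← hc2, ← div_pow] at hsubg
  have hexp_meas : AEStronglyMeasurable (fun ω => Real.exp ((‖X ω‖ / c) ^ 2)) μ :=
    (Real.measurable_exp.comp_aemeasurable
      ((hX.norm.div_const c).pow_const 2)).aestronglyMeasurable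
  have hexp_nonneg : 0 ≤ᵐ[μ] fun ω => Real.exp ((‖X ω‖ / c) ^ 2) :=
    Filter.Eventually.of_forall fun ω => (Real.exp_pos _).le
  have hexp_int : Integrable (fun ω => Real.exp ((‖X ω‖ / c) ^ 2)) μ :=
    (lintegral_ofReal_ne_top_iff_integrable hexp_meas hexp_nonneg).1
      (hsubg.trans_lt ENNReal.ofNat_lt_top).ne
  have hexp_le : ∫ ω, Real.exp ((‖X ω‖ / c) ^ 2) ∂μ ≤ 2 := by
    rw [integral_eq_lintegral_of_nonneg_ae hexp_nonneg hexp_meas]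
    exact ENNReal.toReal_mono (by simp) hsubg
  have hnorm_le : ∀ ω, ‖X ω‖ ≤ c / 2 * Real.exp ((‖X ω‖ / c) ^ 2) := fun ω => by
    have h1 : 2 * (‖X ω‖ / c) ≤ Real.exp ((‖X ω‖ / c) ^ 2) := by
      nlinarith [Real.add_one_le_exp ((‖X ω‖ / c) ^ 2), sq_nonneg (‖X ω‖ / c - 1)]
    calc ‖X ω‖ = c / 2 * (2 * (‖X ω‖ / c)) := by field_simp
      _ ≤ _ := by gcongr
  have hnorm_int : Integrable (fun ω => ‖X ω‖) μ :=
    (hexp_int.const_mul (c / 2)).mono' hX.norm.aestronglyMeasurable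
      (Filter.Eventually.of_forall fun ω => by simpa using hnorm_le ω)
  have hnorm : ∫ ω, ‖X ω‖ ∂μ ≤ c := by
    refine (integral_mono hnorm_int (hexp_int.const_mul (c / 2)) hnorm_le).trans ?_
    rw [integral_const_mul]
    nlinarith
  have hlip : ∀ ω, |f (X ω) - f 0| ≤ ‖X ω‖ := fun ω => by
    simpa [Real.dist_eq] using hf.dist_le_mul (X ω) 0
  have hf_meas : AEStronglyMeasurable (fun ω => f (X ω)) μ :=
    (hf.continuous.measurable.comp_aemeasurable hX).aestronglyMeasurable
  have hdiff_int : Integrable (fun ω => f (X ω) - f 0) μ :=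
    hnorm_int.mono' (hf_meas.sub aestronglyMeasurable_const) (Filter.Eventually.of_forall hlip)
  have hf_int : Integrable (fun ω => f (X ω)) μ := by
    refine (hdiff_int.add (integrable_const (f 0))).congr (Filter.Eventually.of_forall fun ω => ?_)
    simp
  have hf0 : |f 0| ≤ c := by
    have h1 : ∫ ω, (f (X ω) - f 0) ∂μ = -f 0 := by
      rw [integral_sub hf_int (integrable_const _), hmean]
      simp
    rw [← abs_neg, ← h1]
    exact (abs_integral_le_integral_abs.trans
      (integral_mono hdiff_int.abs hnorm_int hlip)).trans hnorm
  have key := lintegral_exp_mul_le_of_abs_le_one_add (h := fun ω => f (X ω) / c)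
    (t := fun ω => ‖X ω‖ / c) (hf_int.div_const c) (by rw [integral_div, hmean, zero_div])
    hexp_int hexp_le (fun ω => by
      rw [abs_div, abs_of_pos hc, div_le_iff₀ hc, add_mul, div_mul_cancel₀ _ hcne, one_mul]
      have h1 := abs_add_le (f (X ω) - f 0) (f 0)
      rw [sub_add_cancel] at h1
      linarith [hlip ω]) (l * c)
  rw [show 8 * d * σ ^ 2 * l ^ 2 = 4 * (l * c) ^ 2 by rw [mul_pow, hc2]; ring]
  simpa only [mul_assoc, mul_div_cancel₀ _ hcne] using key
end

section
/- Let π be a probability measure on ℝᵈ × ℝᵈ with first marginal μ and second marginal ν, and suppose ‖ν‖_{ψ₂} < ∞. For μ-almost every x let π(·|x) denote the conditional distribution of the second coordinate given that the first coordinate equals x (the disintegration of π over its first marginal). Then ∫ ‖π(·|x)‖_{ψ₂}² dμ(x) ≤ 2·‖ν‖_{ψ₂}². (Lemma 9: most conditional measures of a joint distribution are at least as well concentrated as the marginal.) -/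
open MeasureTheory
open scoped ENNReal

/-- The `ψ₂`-norm of a measure `ρ` on `ℝᵈ`:
`‖ρ‖_{ψ₂} = inf {σ > 0 : ∫ exp(‖y‖²/(2dσ²)) dρ ≤ 2}`, with `inf ∅ = ∞`. -/
noncomputable def psi2Norm (d : ℕ) (ρ : Measure (EuclideanSpace ℝ (Fin d))) : ℝ≥0∞ :=
  sInf ((fun σ : ℝ => ENNReal.ofReal σ) ''
    {σ : ℝ | 0 < σ ∧
      ∫⁻ y, ENNReal.ofReal (Real.exp (‖y‖ ^ 2 / (2 * d * σ ^ 2))) ∂ρ ≤ 2})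

theorem exp_div_le_one_add_exp_div (a : ℝ) {t : ℝ} (ht : 1 ≤ t) :
    Real.exp (a / t) ≤ 1 + Real.exp a / t := by
  have ht0 : 0 < t := by linarith
  have hinv : t⁻¹ ≤ 1 := inv_le_one_of_one_le₀ ht
  have hinv0 : 0 ≤ t⁻¹ := by positivity
  have h := convexOn_exp.2 (Set.mem_univ a) (Set.mem_univ 0) hinv0 (sub_nonneg.2 hinv)
    (by ring)
  simp only [smul_eq_mul, mul_zero, add_zero, Real.exp_zero, mul_one] at h
  rw [div_eq_mul_inv, div_eq_mul_inv, mul_comm a, mul_comm (Real.exp a)]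
  linarith

/-- The squared `ψ₂`-norm is at most `σ²` times the exponential moment at scale `σ`. -/
theorem psi2Norm_sq_le_mul_lintegral (d : ℕ) (ρ : Measure (EuclideanSpace ℝ (Fin d)))
    [IsProbabilityMeasure ρ] {σ : ℝ} (hσ : 0 < σ) :
    psi2Norm d ρ ^ 2 ≤ ENNReal.ofReal σ ^ 2 *
      ∫⁻ y, ENNReal.ofReal (Real.exp (‖y‖ ^ 2 / (2 * d * σ ^ 2))) ∂ρ := by
  set h := ∫⁻ y, ENNReal.ofReal (Real.exp (‖y‖ ^ 2 / (2 * d * σ ^ 2))) ∂ρ with hh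
  by_cases htop : h = ⊤
  · rw [htop, ENNReal.mul_top (by simpa using hσ)]
    exact le_top
  have h1 : 1 ≤ h := by
    calc (1 : ℝ≥0∞) = ∫⁻ _, 1 ∂ρ := by simp
      _ ≤ h := lintegral_mono fun y => by
        rw [← ENNReal.ofReal_one]
        exact ENNReal.ofReal_le_ofReal (Real.one_le_exp (by positivity))
  have hpos : 1 ≤ h.toReal := by
    simpa using ENNReal.toReal_mono htop h1
  have hpos0 : 0 < h.toReal := by linarith
  have hsq : √h.toReal ^ 2 = h.toReal := Real.sq_sqrt hpos0.le
  have hle : psi2Norm d ρ ≤ ENNReal.ofReal (σ * √h.toReal) := by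
    refine sInf_le ⟨_, ⟨by positivity, ?_⟩, rfl⟩
    calc ∫⁻ y, ENNReal.ofReal (Real.exp (‖y‖ ^ 2 / (2 * d * (σ * √h.toReal) ^ 2))) ∂ρ
        ≤ ∫⁻ y, (1 + ENNReal.ofReal (Real.exp (‖y‖ ^ 2 / (2 * d * σ ^ 2))) * h⁻¹) ∂ρ := by
          refine lintegral_mono fun y => ?_
          have := exp_div_le_one_add_exp_div (‖y‖ ^ 2 / (2 * d * σ ^ 2)) hpos
          rw [mul_pow, hsq, ← mul_assoc, ← div_div]
          refine (ENNReal.ofReal_le_ofReal this).trans_eq ?_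
          rw [ENNReal.ofReal_add zero_le_one (by positivity), ENNReal.ofReal_one,
            ENNReal.ofReal_div_of_pos hpos0, ENNReal.ofReal_toReal htop, div_eq_mul_inv]
      _ = 1 + h * h⁻¹ := by
          rw [lintegral_add_left measurable_const, lintegral_mul_const _ (by fun_prop), ← hh]
          simp
      _ = 2 := by
          rw [ENNReal.mul_inv_cancel (one_pos.trans_le h1).ne' htop, one_add_one_eq_two]
  calc psi2Norm d ρ ^ 2 ≤ ENNReal.ofReal (σ * √h.toReal) ^ 2 := by gcongr
    _ = ENNReal.ofReal σ ^ 2 * h := by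
      rw [ENNReal.ofReal_mul hσ.le, mul_pow, ← ENNReal.ofReal_pow (Real.sqrt_nonneg _), hsq,
        ENNReal.ofReal_toReal htop]

/-- Lemma 9: if `π` is a coupling on `ℝᵈ × ℝᵈ` with marginals `μ` and `ν` and
`‖ν‖_{ψ₂} < ∞`, then `∫ ‖π(·|x)‖_{ψ₂}² dμ(x) ≤ 2 ‖ν‖_{ψ₂}²`. -/
theorem integral_condKernel_psi2_sq_le
    (d : ℕ) (π : Measure (EuclideanSpace ℝ (Fin d) × EuclideanSpace ℝ (Fin d)))
    [IsProbabilityMeasure π]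
    (μ ν : Measure (EuclideanSpace ℝ (Fin d)))
    (hfst : π.fst = μ) (hsnd : π.snd = ν)
    (hν : psi2Norm d ν < ⊤) :
    ∫⁻ x, (psi2Norm d (π.condKernel x)) ^ 2 ∂μ ≤ 2 * (psi2Norm d ν) ^ 2 := by
  subst hfst hsnd
  set A := ∫⁻ x, (psi2Norm d (π.condKernel x)) ^ 2 ∂π.fst
  have hA : ∀ σ : ℝ, 0 < σ →
      ∫⁻ y, ENNReal.ofReal (Real.exp (‖y‖ ^ 2 / (2 * d * σ ^ 2))) ∂π.snd ≤ 2 →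
      A ≤ 2 * ENNReal.ofReal σ ^ 2 := by
    intro σ hσ hle
    have hmeas : Measurable fun y : EuclideanSpace ℝ (Fin d) =>
        ENNReal.ofReal (Real.exp (‖y‖ ^ 2 / (2 * d * σ ^ 2))) := by fun_prop
    calc A ≤ ∫⁻ x, ENNReal.ofReal σ ^ 2 *
          ∫⁻ y, ENNReal.ofReal (Real.exp (‖y‖ ^ 2 / (2 * d * σ ^ 2))) ∂π.condKernel x ∂π.fst :=
          lintegral_mono fun x => psi2Norm_sq_le_mul_lintegral d _ hσ
      _ = ENNReal.ofReal σ ^ 2 *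
          ∫⁻ y, ENNReal.ofReal (Real.exp (‖y‖ ^ 2 / (2 * d * σ ^ 2))) ∂π.snd := by
          rw [lintegral_const_mul _ hmeas.lintegral_kernel, Measure.snd,
            lintegral_map hmeas measurable_snd]
          exact congrArg _ (Measure.lintegral_condKernel (ρ := π) (hmeas.comp measurable_snd))
      _ ≤ 2 * ENNReal.ofReal σ ^ 2 := by
          rw [mul_comm]
          gcongr
  have hroot : (A / 2) ^ (1 / 2 : ℝ) ≤ psi2Norm d π.snd := by
    refine le_sInf ?_
    rintro _ ⟨σ, ⟨hσ, hle⟩, rfl⟩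
    rw [one_div, ENNReal.rpow_inv_le_iff two_pos, ENNReal.rpow_two]
    exact ENNReal.div_le_of_le_mul' (hA σ hσ hle)
  rw [one_div, ENNReal.rpow_inv_le_iff two_pos, ENNReal.rpow_two] at hroot
  rwa [ENNReal.div_le_iff two_ne_zero ENNReal.ofNat_ne_top, mul_comm] at hroot
end

section
/- Let c > 0 and let ν be a probability measure on ℝᵈ with density proportional to e^{−W} with respect to Lebesgue measure, where W : ℝᵈ → ℝ is c-strongly convex (i.e., y ↦ W(y) − (c/2)‖y‖² is convex). Then for every 1-Lipschitz function f : ℝᵈ → ℝ with ∫ f dν = 0 and every λ ≥ 0, ∫ exp(λ·f(y)) dν(y) ≤ exp(λ²/(2c)). (Theorem 10: the Laplace functional of a c-strongly log-concave measure satisfies E_ν(λ) ≤ exp((1/c)·λ²/2).) -/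
open MeasureTheory
open scoped ENNReal Pointwise

/-- One-dimensional Brunn–Minkowski inequality for compact sets. -/
lemma volume_add_volume_le_of_isCompact {K L C : Set ℝ} (hK : IsCompact K) (hL : IsCompact L)
    (hKn : K.Nonempty) (hLn : L.Nonempty) (h : ∀ x ∈ K, ∀ y ∈ L, x + y ∈ C) :
    volume K + volume L ≤ volume C := by
  obtain ⟨a, ha, ha'⟩ := hK.exists_isGreatest hKn
  obtain ⟨b, hb, hb'⟩ := hL.exists_isLeast hLn
  have hmeas : MeasurableSet ((fun y => a + y) '' L) :=
    (hL.image (by fun_prop)).isClosed.measurableSet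
  have hdisj : AEDisjoint volume ((fun x => x + b) '' K) ((fun y => a + y) '' L) := by
    refine measure_mono_null (t := {a + b}) ?_ (by simp)
    rintro _ ⟨⟨x, hx, rfl⟩, ⟨y, hy, hxy⟩⟩
    have h1 := ha' hx
    have h2 := hb' hy
    simp only [Set.mem_singleton_iff] at *
    linarith
  calc volume K + volume L
      = volume ((fun x => x + b) '' K) + volume ((fun y => a + y) '' L) := by
        rw [Set.image_add_right, Set.image_add_left, measure_preimage_add_right,
          measure_preimage_add]
    _ = volume (((fun x => x + b) '' K) ∪ ((fun y => a + y) '' L)) :=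
        (measure_union₀ hmeas.nullMeasurableSet hdisj).symm
    _ ≤ volume C := by
        refine measure_mono ?_
        rintro _ (⟨x, hx, rfl⟩ | ⟨y, hy, rfl⟩)
        · exact h x hx b hb
        · exact h a ha y hy

/-- One-dimensional Brunn–Minkowski inequality for measurable sets. -/
lemma volume_add_volume_le {A B C : Set ℝ} (hA : MeasurableSet A) (hB : MeasurableSet B)
    (hAn : A.Nonempty) (hBn : B.Nonempty) (h : ∀ x ∈ A, ∀ y ∈ B, x + y ∈ C) :
    volume A + volume B ≤ volume C := by
  obtain ⟨a, ha⟩ := hAn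
  obtain ⟨b, hb⟩ := hBn
  have hreg : ∀ {S : Set ℝ}, MeasurableSet S →
      volume S = ⨆ K : Set ℝ, ⨆ _ : K ⊆ S ∧ IsCompact K, volume K := fun hS => by
    simp_rw [iSup_and]
    exact hS.measure_eq_iSup_isCompact volume
  rw [hreg hA, hreg hB]
  refine ENNReal.biSup_add_biSup_le' ⟨∅, by simp⟩ ⟨∅, by simp⟩ ?_
  rintro K ⟨hKA, hK⟩ L ⟨hLB, hL⟩
  calc volume K + volume L ≤ volume (insert a K) + volume (insert b L) := by
        gcongr <;> exact Set.subset_insert _ _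
    _ ≤ volume C := by
        refine volume_add_volume_le_of_isCompact (hK.insert a) (hL.insert b)
          (Set.insert_nonempty _ _) (Set.insert_nonempty _ _) fun x hx y hy => h x ?_ y ?_
        · exact Set.insert_subset ha hKA hx
        · exact Set.insert_subset hb hLB hy

lemma ofReal_mul_volume_add_le {s r : ℝ} (hs : 0 < s) (hr : 0 < r) {A B C : Set ℝ}
    (hA : MeasurableSet A) (hB : MeasurableSet B)
    (hAn : A.Nonempty) (hBn : B.Nonempty) (h : ∀ x ∈ A, ∀ y ∈ B, s • x + r • y ∈ C) :
    ENNReal.ofReal s * volume A + ENNReal.ofReal r * volume B ≤ volume C := by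
  have key : volume (s • A) + volume (r • B) ≤ volume C := by
    refine volume_add_volume_le (hA.const_smul_of_ne_zero hs.ne')
      (hB.const_smul_of_ne_zero hr.ne') (hAn.smul_set) (hBn.smul_set) ?_
    rintro _ ⟨x, hx, rfl⟩ _ ⟨y, hy, rfl⟩
    exact h x hx y hy
  simpa [Measure.addHaar_smul, abs_of_pos hs, abs_of_pos hr] using key

lemma ENNReal.rpow_mul_rpow_le_add {s r : ℝ} (hs : 0 < s) (hr : 0 < r) (hsr : s + r = 1)
    (a b : ℝ≥0∞) : a ^ s * b ^ r ≤ ENNReal.ofReal s * a + ENNReal.ofReal r * b := by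
  rcases eq_or_ne a ⊤ with rfl | ha
  · simp [ENNReal.mul_top, hs]
  rcases eq_or_ne b ⊤ with rfl | hb
  · simp [ENNReal.mul_top, hr]
  rw [← ENNReal.ofReal_toReal ha, ← ENNReal.ofReal_toReal hb,
    ENNReal.ofReal_rpow_of_nonneg (by positivity) hs.le,
    ENNReal.ofReal_rpow_of_nonneg (by positivity) hr.le,
    ← ENNReal.ofReal_mul (by positivity), ← ENNReal.ofReal_mul hs.le, ← ENNReal.ofReal_mul hr.le,
    ← ENNReal.ofReal_add (by positivity) (by positivity)]
  exact ENNReal.ofReal_le_ofReal (Real.geom_mean_le_arith_mean2_weighted hs.le hr.le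
    (by positivity) (by positivity) hsr)

lemma lintegral_eq_lintegral_volume_lt_of_le_one {f : ℝ → ℝ≥0∞} (hf : Measurable f)
    (hf1 : ∀ x, f x ≤ 1) :
    ∫⁻ x, f x = ∫⁻ t in Set.Ioi (0 : ℝ), volume {x | ENNReal.ofReal t < f x} := by
  have hne : ∀ x, f x ≠ ⊤ := fun x => ((hf1 x).trans_lt ENNReal.one_lt_top).ne
  calc ∫⁻ x, f x = ∫⁻ x, ENNReal.ofReal (f x).toReal := by
        simp only [ENNReal.ofReal_toReal (hne _)]
    _ = ∫⁻ t in Set.Ioi (0 : ℝ), volume {x | t < (f x).toReal} :=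
        lintegral_eq_lintegral_meas_lt _ (ae_of_all _ fun x => ENNReal.toReal_nonneg)
          hf.ennreal_toReal.aemeasurable
    _ = _ := by
        refine setLIntegral_congr_fun measurableSet_Ioi fun t ht => ?_
        have ht' : 0 ≤ t := le_of_lt ht
        simp only [ENNReal.ofReal_lt_iff_lt_toReal ht' (hne _)]

lemma prekopaLeindler_real_of_iSup_eq_one {s r : ℝ} (hs : 0 < s) (hr : 0 < r) (hsr : s + r = 1)
    {u v h : ℝ → ℝ≥0∞} (hu : Measurable u) (hv : Measurable v) (hh : Measurable h)
    (hu1 : ⨆ x, u x = 1) (hv1 : ⨆ x, v x = 1)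
    (huvh : ∀ x y, u x ^ s * v y ^ r ≤ h (s • x + r • y)) :
    (∫⁻ x, u x) ^ s * (∫⁻ x, v x) ^ r ≤ ∫⁻ x, h x := by
  have hu1' : ∀ x, u x ≤ 1 := fun x => hu1 ▸ le_iSup u x
  have hv1' : ∀ x, v x ≤ 1 := fun x => hv1 ▸ le_iSup v x
  have hvol : ∀ t ∈ Set.Ioi (0 : ℝ), ENNReal.ofReal s * volume {x | ENNReal.ofReal t < u x} +
      ENNReal.ofReal r * volume {x | ENNReal.ofReal t < v x} ≤
        volume {x | ENNReal.ofReal t < min (h x) 1} := by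
    intro t ht
    rcases lt_or_ge t 1 with ht1 | ht1
    · have hlt : ENNReal.ofReal t < 1 := ENNReal.ofReal_lt_one.2 ht1
      refine ofReal_mul_volume_add_le hs hr (measurableSet_lt measurable_const hu)
        (measurableSet_lt measurable_const hv) (lt_iSup_iff.1 (hlt.trans_eq hu1.symm))
        (lt_iSup_iff.1 (hlt.trans_eq hv1.symm)) ?_
      intro x hx y hy
      refine lt_min (lt_of_lt_of_le ?_ (huvh x y)) hlt
      calc ENNReal.ofReal t = ENNReal.ofReal t ^ s * ENNReal.ofReal t ^ r := by
            rw [← ENNReal.rpow_add_of_nonneg _ _ hs.le hr.le, hsr, ENNReal.rpow_one]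
        _ < u x ^ s * v y ^ r :=
            ENNReal.mul_lt_mul (ENNReal.rpow_lt_rpow hx hs) (ENNReal.rpow_lt_rpow hy hr)
    · have hge : 1 ≤ ENNReal.ofReal t := by simpa using ht1
      have h1 : {x | ENNReal.ofReal t < u x} = ∅ :=
        Set.eq_empty_of_forall_notMem fun x hx => not_lt.2 ((hu1' x).trans hge) hx
      have h2 : {x | ENNReal.ofReal t < v x} = ∅ :=
        Set.eq_empty_of_forall_notMem fun x hx => not_lt.2 ((hv1' x).trans hge) hx
      simp [h1, h2]
  have hmeas : ∀ f : ℝ → ℝ≥0∞, Measurable fun t : ℝ => volume {x | ENNReal.ofReal t < f x} :=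
    fun f => Antitone.measurable fun a b hab => measure_mono fun x hx =>
      lt_of_le_of_lt (ENNReal.ofReal_le_ofReal hab) hx
  calc (∫⁻ x, u x) ^ s * (∫⁻ x, v x) ^ r
      ≤ ENNReal.ofReal s * (∫⁻ x, u x) + ENNReal.ofReal r * (∫⁻ x, v x) :=
        ENNReal.rpow_mul_rpow_le_add hs hr hsr _ _
    _ = ∫⁻ t in Set.Ioi (0 : ℝ), (ENNReal.ofReal s * volume {x | ENNReal.ofReal t < u x} +
          ENNReal.ofReal r * volume {x | ENNReal.ofReal t < v x}) := by
        rw [lintegral_eq_lintegral_volume_lt_of_le_one hu hu1',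
          lintegral_eq_lintegral_volume_lt_of_le_one hv hv1',
          lintegral_add_left ((hmeas u).const_mul _), lintegral_const_mul _ (hmeas u),
          lintegral_const_mul _ (hmeas v)]
    _ ≤ ∫⁻ t in Set.Ioi (0 : ℝ), volume {x | ENNReal.ofReal t < min (h x) 1} :=
        setLIntegral_mono (hmeas _) hvol
    _ = ∫⁻ x, min (h x) 1 :=
        (lintegral_eq_lintegral_volume_lt_of_le_one (hh.min measurable_const)
          fun x => min_le_right _ _).symm
    _ ≤ ∫⁻ x, h x := lintegral_mono fun x => min_le_left _ _

lemma prekopaLeindler_real_of_iSup_ne_top {s r : ℝ} (hs : 0 < s) (hr : 0 < r) (hsr : s + r = 1)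
    {u v h : ℝ → ℝ≥0∞} (hu : Measurable u) (hv : Measurable v) (hh : Measurable h)
    (hu' : ⨆ x, u x ≠ ⊤) (hv' : ⨆ x, v x ≠ ⊤)
    (huvh : ∀ x y, u x ^ s * v y ^ r ≤ h (s • x + r • y)) :
    (∫⁻ x, u x) ^ s * (∫⁻ x, v x) ^ r ≤ ∫⁻ x, h x := by
  set a := ⨆ x, u x with ha
  set b := ⨆ x, v x with hb
  rcases eq_or_ne a 0 with ha0 | ha0
  · have : ∀ x, u x = 0 := ENNReal.iSup_eq_zero.1 ha0
    simp [this, hs]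
  rcases eq_or_ne b 0 with hb0 | hb0
  · have : ∀ x, v x = 0 := ENNReal.iSup_eq_zero.1 hb0
    simp [this, hr]
  have hu1 : ⨆ x, a⁻¹ * u x = 1 := by
    rw [← ENNReal.mul_iSup, ← ha, ENNReal.inv_mul_cancel ha0 hu']
  have hv1 : ⨆ x, b⁻¹ * v x = 1 := by
    rw [← ENNReal.mul_iSup, ← hb, ENNReal.inv_mul_cancel hb0 hv']
  have key := prekopaLeindler_real_of_iSup_eq_one (h := fun x => (a ^ s * b ^ r)⁻¹ * h x)
    hs hr hsr (hu.const_mul _) (hv.const_mul _) (hh.const_mul _) hu1 hv1 ?_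
  · rw [lintegral_const_mul _ hu, lintegral_const_mul _ hv, lintegral_const_mul _ hh,
      ENNReal.mul_rpow_of_nonneg _ _ hs.le, ENNReal.mul_rpow_of_nonneg _ _ hr.le, mul_mul_mul_comm,
      ENNReal.inv_rpow, ENNReal.inv_rpow, ← ENNReal.mul_inv (by simp [ha0, hu', hs])
        (by simp [ha0, hu', hs])] at key
    refine (ENNReal.mul_le_mul_iff_right ?_ ?_).1 key
    · simp [ENNReal.mul_eq_top, ha0, hb0, hu', hv', hs, hr]
    · simp [ha0, hb0, hu', hv', hs, hr]
  · intro x y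
    rw [ENNReal.mul_rpow_of_nonneg _ _ hs.le, ENNReal.mul_rpow_of_nonneg _ _ hr.le,
      mul_mul_mul_comm, ENNReal.inv_rpow, ENNReal.inv_rpow,
      ← ENNReal.mul_inv (by simp [ha0, hu', hs]) (by simp [ha0, hu', hs])]
    gcongr
    exact huvh x y

/-- A measure `μ` satisfies the Prékopa–Leindler inequality with weights `s` and `r`. -/
def PrekopaLeindler {E : Type*} [AddCommGroup E] [Module ℝ E] [MeasurableSpace E] (s r : ℝ)
    (μ : Measure E) : Prop :=
  ∀ u v h : E → ℝ≥0∞, Measurable u → Measurable v → Measurable h →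
    (∀ x y, u x ^ s * v y ^ r ≤ h (s • x + r • y)) →
    (∫⁻ x, u x ∂μ) ^ s * (∫⁻ x, v x ∂μ) ^ r ≤ ∫⁻ x, h x ∂μ

lemma tendsto_lintegral_min_natCast {α : Type*} [MeasurableSpace α] (μ : Measure α)
    {u : α → ℝ≥0∞} (hu : Measurable u) :
    Filter.Tendsto (fun n : ℕ => ∫⁻ x, min (u x) n ∂μ) Filter.atTop (nhds (∫⁻ x, u x ∂μ)) := by
  refine lintegral_tendsto_of_tendsto_of_monotone (fun n => (hu.min measurable_const).aemeasurable)
    (ae_of_all _ fun x m n hmn => min_le_min_left _ (by exact_mod_cast hmn))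
    (ae_of_all _ fun x => ?_)
  simpa using (tendsto_const_nhds (x := u x)).min ENNReal.tendsto_nat_nhds_top

/-- The one-dimensional Prékopa–Leindler inequality. -/
lemma prekopaLeindler_real {s r : ℝ} (hs : 0 < s) (hr : 0 < r) (hsr : s + r = 1) :
    PrekopaLeindler s r (volume : Measure ℝ) := by
  intro u v h hu hv hh huvh
  rcases eq_or_ne (∫⁻ x, u x) 0 with hu0 | hu0
  · simp [hu0, hs]
  rcases eq_or_ne (∫⁻ x, v x) 0 with hv0 | hv0
  · simp [hv0, hr]
  have hlim := ENNReal.Tendsto.mul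
    ((ENNReal.continuous_rpow_const (y := s)).tendsto _ |>.comp
      (tendsto_lintegral_min_natCast volume hu))
    (Or.inl (by simp [hu0, hs, hs.le]))
    ((ENNReal.continuous_rpow_const (y := r)).tendsto _ |>.comp
      (tendsto_lintegral_min_natCast volume hv))
    (Or.inl (by simp [hv0, hr, hr.le]))
  have hne_top : ∀ (w : ℝ → ℝ≥0∞) (n : ℕ), ⨆ x, min (w x) (n : ℝ≥0∞) ≠ ⊤ := fun w n =>
    ((iSup_le fun x => min_le_right _ _).trans_lt (ENNReal.natCast_lt_top n)).ne
  refine le_of_tendsto' hlim fun n => ?_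
  refine prekopaLeindler_real_of_iSup_ne_top hs hr hsr (hu.min measurable_const)
    (hv.min measurable_const) hh (hne_top u n) (hne_top v n) fun x y => le_trans ?_ (huvh x y)
  gcongr <;> exact min_le_left _ _

lemma PrekopaLeindler.prod {E F : Type*} [AddCommGroup E] [Module ℝ E] [MeasurableSpace E]
    [AddCommGroup F] [Module ℝ F] [MeasurableSpace F] {s r : ℝ} {μ : Measure E} {ν : Measure F}
    [SFinite ν] (hμ : PrekopaLeindler s r μ) (hν : PrekopaLeindler s r ν) :
    PrekopaLeindler s r (μ.prod ν) := by
  intro u v h hu hv hh huvh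
  rw [lintegral_prod _ hu.aemeasurable, lintegral_prod _ hv.aemeasurable,
    lintegral_prod _ hh.aemeasurable]
  refine hμ _ _ _ hu.lintegral_prod_right' hv.lintegral_prod_right' hh.lintegral_prod_right' ?_
  intro x y
  exact hν _ _ _ (hu.comp measurable_prodMk_left) (hv.comp measurable_prodMk_left)
    (hh.comp measurable_prodMk_left) fun x' y' => huvh (x, x') (y, y')

lemma PrekopaLeindler.of_measurePreserving {E F : Type*} [AddCommGroup E] [Module ℝ E]
    [MeasurableSpace E] [AddCommGroup F] [Module ℝ F] [MeasurableSpace F] {s r : ℝ}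
    {μ : Measure E} {ν : Measure F} (hμ : PrekopaLeindler s r μ) (φ : E →ₗ[ℝ] F)
    (hφ : MeasurePreserving φ μ ν) : PrekopaLeindler s r ν := by
  intro u v h hu hv hh huvh
  rw [← hφ.lintegral_comp hu, ← hφ.lintegral_comp hv, ← hφ.lintegral_comp hh]
  refine hμ _ _ _ (hu.comp hφ.measurable) (hv.comp hφ.measurable) (hh.comp hφ.measurable) ?_
  intro x y
  simpa using huvh (φ x) (φ y)

lemma prekopaLeindler_pi {s r : ℝ} (hs : 0 < s) (hr : 0 < r) (hsr : s + r = 1) (n : ℕ) :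
    PrekopaLeindler s r (volume : Measure (Fin n → ℝ)) := by
  induction n with
  | zero =>
    intro u v h hu hv hh huvh
    have := huvh 0 0
    simpa [volume_pi, Measure.pi_of_empty _ (0 : Fin 0 → ℝ), lintegral_dirac] using this
  | succ n ih =>
    refine ((prekopaLeindler_real hs hr hsr).prod ih).of_measurePreserving
      (Fin.consLinearEquiv ℝ fun _ : Fin (n + 1) => ℝ).toLinearMap ?_
    convert! (volume_preserving_piFinSuccAbove (fun _ : Fin (n + 1) => ℝ) 0).symm using 1
    ext x i
    simp [MeasurableEquiv.piFinSuccAbove, Fin.insertNthEquiv]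

/-- The Prékopa–Leindler inequality on Euclidean space. -/
theorem prekopaLeindler_euclideanSpace {s r : ℝ} (hs : 0 < s) (hr : 0 < r) (hsr : s + r = 1)
    (n : ℕ) : PrekopaLeindler s r (volume : Measure (EuclideanSpace ℝ (Fin n))) :=
  (prekopaLeindler_pi hs hr hsr n).of_measurePreserving
    (WithLp.linearEquiv 2 ℝ (Fin n → ℝ)).symm.toLinearMap (PiLp.volume_preserving_toLp (Fin n))

lemma ConvexOn.add_sq_le_of_stronglyConvex {E : Type*} [NormedAddCommGroup E]
    [InnerProductSpace ℝ E] {c : ℝ} {W : E → ℝ}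
    (hW : ConvexOn ℝ Set.univ (fun y => W y - (c / 2) * ‖y‖ ^ 2)) {s r : ℝ} (hs : 0 ≤ s)
    (hr : 0 ≤ r) (hsr : s + r = 1) (x y : E) :
    W (s • x + r • y) + c / 2 * (s * r) * ‖x - y‖ ^ 2 ≤ s * W x + r * W y := by
  have h := hW.2 (Set.mem_univ x) (Set.mem_univ y) hs hr hsr
  have h1 : ‖s • x + r • y‖ ^ 2
      = s ^ 2 * ‖x‖ ^ 2 + 2 * (s * r * inner ℝ x y) + r ^ 2 * ‖y‖ ^ 2 := by
    rw [norm_add_sq_real, norm_smul, norm_smul, inner_smul_left, inner_smul_right, mul_pow, mul_pow,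
      Real.norm_eq_abs, Real.norm_eq_abs, sq_abs, sq_abs]
    simp only [conj_trivial]
    ring
  obtain rfl : r = 1 - s := by linarith
  simp only [smul_eq_mul, h1] at h
  rw [norm_sub_sq_real]
  linarith

section LaplaceFunctional

variable {d : ℕ} {c : ℝ} {W : EuclideanSpace ℝ (Fin d) → ℝ}
  {ν : Measure (EuclideanSpace ℝ (Fin d))} {Z : ℝ} {f : EuclideanSpace ℝ (Fin d) → ℝ}

lemma lintegral_exp_rpow_mul_lintegral_exp_rpow_le (hc : 0 < c)
    (hW : ConvexOn ℝ Set.univ (fun y => W y - (c / 2) * ‖y‖ ^ 2)) [IsProbabilityMeasure ν]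
    (hZ : 0 < Z) (hν : ν = volume.withDensity (fun y => ENNReal.ofReal (Real.exp (-W y) / Z)))
    (hf : LipschitzWith 1 f) {l : ℝ} (hl : 0 ≤ l) {s r : ℝ} (hs : 0 < s) (hr : 0 < r)
    (hsr : s + r = 1) :
    (∫⁻ y, ENNReal.ofReal (Real.exp (l * f y)) ∂ν) ^ s *
        (∫⁻ y, ENNReal.ofReal (Real.exp (-(s / r * l) * f y)) ∂ν) ^ r ≤
      ENNReal.ofReal (Real.exp (s * (l ^ 2 / (2 * c * r)))) := by
  have hWc : Continuous W := by
    have h := hW.locallyLipschitz.continuous.add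
      (by fun_prop : Continuous fun y : EuclideanSpace ℝ (Fin d) => c / 2 * ‖y‖ ^ 2)
    exact h.congr fun y => by simp
  have hfc : Continuous f := hf.continuous
  have hdens : ∀ y, Real.exp (-W y) / Z = Real.exp (-W y - Real.log Z) := fun y => by
    rw [Real.exp_sub, Real.exp_log hZ]
  simp only [hdens] at hν
  have hint : ∀ g : EuclideanSpace ℝ (Fin d) → ℝ, Continuous g →
      ∫⁻ y, ENNReal.ofReal (Real.exp (g y)) ∂ν =
        ∫⁻ y, ENNReal.ofReal (Real.exp (-W y - Real.log Z + g y)) := fun g hg => by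
    rw [hν, lintegral_withDensity_eq_lintegral_mul _ (by fun_prop) (by fun_prop)]
    simp only [Pi.mul_apply, ← ENNReal.ofReal_mul (Real.exp_pos _).le, ← Real.exp_add]
  have hconst : ENNReal.ofReal (Real.exp (s * (l ^ 2 / (2 * c * r)))) =
      ∫⁻ y, ENNReal.ofReal (Real.exp (-W y - Real.log Z + s * (l ^ 2 / (2 * c * r)))) := by
    rw [← hint (fun _ => s * (l ^ 2 / (2 * c * r))) continuous_const]
    simp
  rw [hint _ (by fun_prop), hint _ (by fun_prop), hconst]
  refine prekopaLeindler_euclideanSpace hs hr hsr d _ _ _ (by fun_prop) (by fun_prop)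
    (by fun_prop) fun x y => ?_
  rw [ENNReal.ofReal_rpow_of_nonneg (Real.exp_pos _).le hs.le,
    ENNReal.ofReal_rpow_of_nonneg (Real.exp_pos _).le hr.le, ← ENNReal.ofReal_mul (by positivity),
    ← Real.exp_mul, ← Real.exp_mul, ← Real.exp_add]
  refine ENNReal.ofReal_le_ofReal (Real.exp_le_exp.2 ?_)
  have hconv := hW.add_sq_le_of_stronglyConvex hs.le hr.le hsr x y
  have hlip : f x - f y ≤ ‖x - y‖ := by
    have := hf.dist_le_mul x y
    rw [NNReal.coe_one, one_mul, Real.dist_eq, dist_eq_norm] at this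
    exact (le_abs_self _).trans this
  have hyoung : l * (f x - f y) ≤ l ^ 2 / (2 * c * r) + c * r / 2 * ‖x - y‖ ^ 2 := by
    have hsq : l ^ 2 / (2 * c * r) + c * r / 2 * ‖x - y‖ ^ 2 - l * ‖x - y‖
        = (l - c * r * ‖x - y‖) ^ 2 / (2 * c * r) := by
      field_simp
      ring
    have hsq0 : 0 ≤ (l - c * r * ‖x - y‖) ^ 2 / (2 * c * r) := by positivity
    have := mul_le_mul_of_nonneg_left hlip hl
    linarith
  have hyoung' := mul_le_mul_of_nonneg_left hyoung hs.le
  have hcancel : -(s / r * l) * f y * r = -(s * l * f y) := by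
    field_simp
  have hlog : s * Real.log Z + r * Real.log Z = Real.log Z := by rw [← add_mul, hsr, one_mul]
  calc (-W x - Real.log Z + l * f x) * s + (-W y - Real.log Z + -(s / r * l) * f y) * r
      = -(s * W x + r * W y) - (s * Real.log Z + r * Real.log Z) + s * (l * (f x - f y)) := by
        linear_combination hcancel
    _ ≤ _ := by
        rw [hlog]
        linarith

lemma lintegral_exp_ne_zero (hf : Continuous f) [IsProbabilityMeasure ν] :
    ∫⁻ y, ENNReal.ofReal (Real.exp (f y)) ∂ν ≠ 0 := by
  rw [Ne, lintegral_eq_zero_iff (by fun_prop)]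
  intro h
  obtain ⟨y, hy⟩ := h.exists
  exact absurd hy (by simp [Real.exp_pos])

lemma integrable_exp_mul_of_lipschitzWith (hc : 0 < c)
    (hW : ConvexOn ℝ Set.univ (fun y => W y - (c / 2) * ‖y‖ ^ 2)) [IsProbabilityMeasure ν]
    (hZ : 0 < Z) (hν : ν = volume.withDensity (fun y => ENNReal.ofReal (Real.exp (-W y) / Z)))
    (hf : LipschitzWith 1 f) (l : ℝ) :
    Integrable (fun y => Real.exp (l * f y)) ν := by
  have hfc : Continuous f := hf.continuous
  have hpos : ∀ {g : EuclideanSpace ℝ (Fin d) → ℝ}, LipschitzWith 1 g → ∀ {l : ℝ}, 0 ≤ l →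
      Integrable (fun y => Real.exp (l * g y)) ν := by
    intro g hg l hl
    have hgc : Continuous g := hg.continuous
    refine ⟨by fun_prop, ?_⟩
    rw [hasFiniteIntegral_iff_ofReal (ae_of_all _ fun y => (Real.exp_pos _).le)]
    have key := lintegral_exp_rpow_mul_lintegral_exp_rpow_le hc hW hZ hν hg hl
      (s := 1 / 2) (r := 1 / 2) (by norm_num) (by norm_num) (by norm_num)
    have hne := lintegral_exp_ne_zero (ν := ν)
      (f := fun y => -((1 / 2 : ℝ) / (1 / 2) * l) * g y) (by fun_prop)
    rw [lt_top_iff_ne_top]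
    intro htop
    rw [htop, ENNReal.top_rpow_of_pos (by norm_num), ENNReal.top_mul (by simpa using hne)] at key
    exact ENNReal.ofReal_ne_top (top_le_iff.1 key)
  rcases le_total 0 l with hl | hl
  · exact hpos hf hl
  · simpa using hpos hf.neg (neg_nonneg.2 hl)

lemma one_le_lintegral_exp_of_integral_eq_zero [IsProbabilityMeasure ν] (hf : Integrable f ν)
    (hexp : Integrable (fun y => Real.exp (f y)) ν) (hf0 : ∫ y, f y ∂ν = 0) :
    1 ≤ ∫⁻ y, ENNReal.ofReal (Real.exp (f y)) ∂ν := by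
  rw [← ofReal_integral_eq_lintegral_ofReal hexp (ae_of_all _ fun y => (Real.exp_pos _).le),
    ENNReal.one_le_ofReal]
  calc (1 : ℝ) = ∫ y, (f y + 1) ∂ν := by
        rw [integral_add hf (integrable_const _), hf0]
        simp
    _ ≤ ∫ y, Real.exp (f y) ∂ν :=
        integral_mono (hf.add (integrable_const _)) hexp fun y => Real.add_one_le_exp _

end LaplaceFunctional

/-- Theorem 10: the Laplace functional of a `c`-strongly log-concave probability measure
`ν ∝ e^{-W}` satisfies `∫ exp(λ f) dν ≤ exp(λ²/(2c))` for every 1-Lipschitz `f` with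
`∫ f dν = 0` and every `λ ≥ 0`. -/
theorem laplace_functional_of_stronglyLogConcave
    (d : ℕ) (c : ℝ) (hc : 0 < c)
    (W : EuclideanSpace ℝ (Fin d) → ℝ)
    (hW : ConvexOn ℝ Set.univ (fun y => W y - (c / 2) * ‖y‖ ^ 2))
    (ν : Measure (EuclideanSpace ℝ (Fin d))) [IsProbabilityMeasure ν]
    (Z : ℝ) (hZ : 0 < Z)
    (hν : ν = volume.withDensity (fun y => ENNReal.ofReal (Real.exp (-W y) / Z))) :
    ∀ f : EuclideanSpace ℝ (Fin d) → ℝ, LipschitzWith 1 f → (∫ y, f y ∂ν = 0) →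
      ∀ l : ℝ, 0 ≤ l →
        ∫⁻ y, ENNReal.ofReal (Real.exp (l * f y)) ∂ν
          ≤ ENNReal.ofReal (Real.exp (l ^ 2 / (2 * c))) := by
  intro f hf hf0 l hl
  have hexp := integrable_exp_mul_of_lipschitzWith hc hW hZ hν hf
  have hfint : Integrable f ν := by
    refine ((hexp 1).add (hexp (-1))).mono' hf.continuous.aestronglyMeasurable
      (ae_of_all _ fun y => ?_)
    have h1 := Real.add_one_le_exp (1 * f y)
    have h2 := Real.add_one_le_exp (-1 * f y)
    have h3 := Real.exp_pos (1 * f y)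
    have h4 := Real.exp_pos (-1 * f y)
    simp only [Pi.add_apply, Real.norm_eq_abs]
    exact abs_le.2 ⟨by linarith, by linarith⟩
  have hbound : ∀ r ∈ Set.Ioo (0 : ℝ) 1, ∫⁻ y, ENNReal.ofReal (Real.exp (l * f y)) ∂ν ≤
      ENNReal.ofReal (Real.exp (l ^ 2 / (2 * c * r))) := by
    rintro r ⟨hr0, hr1⟩
    have hs : 0 < 1 - r := sub_pos.2 hr1
    have hjensen := one_le_lintegral_exp_of_integral_eq_zero
      (hfint.const_mul (-((1 - r) / r * l))) (hexp _) (by rw [integral_const_mul, hf0, mul_zero])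
    refine (ENNReal.rpow_le_rpow_iff hs).1 ?_
    calc (∫⁻ y, ENNReal.ofReal (Real.exp (l * f y)) ∂ν) ^ (1 - r)
        ≤ (∫⁻ y, ENNReal.ofReal (Real.exp (l * f y)) ∂ν) ^ (1 - r) *
          (∫⁻ y, ENNReal.ofReal (Real.exp (-((1 - r) / r * l) * f y)) ∂ν) ^ r :=
          le_mul_of_one_le_right' (ENNReal.one_le_rpow hjensen hr0)
      _ ≤ ENNReal.ofReal (Real.exp ((1 - r) * (l ^ 2 / (2 * c * r)))) :=
          lintegral_exp_rpow_mul_lintegral_exp_rpow_le hc hW hZ hν hf hl hs hr0 (by ring)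
      _ = ENNReal.ofReal (Real.exp (l ^ 2 / (2 * c * r))) ^ (1 - r) := by
          rw [ENNReal.ofReal_rpow_of_nonneg (Real.exp_pos _).le hs.le, ← Real.exp_mul, mul_comm]
  have hlim : Filter.Tendsto (fun r : ℝ => ENNReal.ofReal (Real.exp (l ^ 2 / (2 * c * r))))
      (nhdsWithin 1 (Set.Iio 1)) (nhds (ENNReal.ofReal (Real.exp (l ^ 2 / (2 * c))))) := by
    have hcont : ContinuousAt
        (fun r : ℝ => ENNReal.ofReal (Real.exp (l ^ 2 / (2 * c * r)))) 1 := by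
      refine ENNReal.continuous_ofReal.continuousAt.comp (Real.continuous_exp.continuousAt.comp ?_)
      exact continuousAt_const.div (by fun_prop) (by positivity)
    simpa using hcont.tendsto.mono_left nhdsWithin_le_nhds
  refine ge_of_tendsto hlim ?_
  filter_upwards [Ioo_mem_nhdsLT (zero_lt_one' ℝ)] with r hr using hbound r hr
end

section
/- Let μ be a probability measure on ℝᵈ, ε > 0, and h : ℝᵈ → ℝ measurable such that for every y ∈ ℝᵈ the integral ∫ exp((h(x) − (1/2)‖y − x‖²)/ε) dμ(x) is finite and strictly positive, and define g(y) = −ε·log ∫ exp((h(x) − (1/2)‖y − x‖²)/ε) dμ(x). Let c > 0 and let W : ℝᵈ → ℝ be c-strongly convex. Then for every x ∈ ℝᵈ the function y ↦ W(y) + (1/ε)·((1/2)‖x − y‖² − g(y)) is c-strongly convex, i.e., its difference with (c/2)‖y‖² is convex. (Lemma 11: if the target measure ν ∝ e^{−W} is c-strongly log-concave, then every conditional measure π_ε(·|x) of the entropic optimal coupling, whose negative log-density relative to Lebesgue measure is the displayed function up to an additive constant, is also c-strongly log-concave, with constant independent of x.) -/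
open MeasureTheory

/-- If `φ · x` is convex for every `x`, then so is `y ↦ log ∫ exp (φ y x) ∂μ`. -/
theorem convexOn_log_integral_exp {α E : Type*} [MeasurableSpace α] [AddCommGroup E] [Module ℝ E]
    {μ : Measure α} {s : Set E} (hs : Convex ℝ s) {φ : E → α → ℝ}
    (hφ : ∀ x, ConvexOn ℝ s (fun y => φ y x))
    (hint : ∀ y ∈ s, Integrable (fun x => Real.exp (φ y x)) μ)
    (hpos : ∀ y ∈ s, 0 < ∫ x, Real.exp (φ y x) ∂μ) :
    ConvexOn ℝ s (fun y => Real.log (∫ x, Real.exp (φ y x) ∂μ)) := by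
  refine ⟨hs, fun y hy z hz a b ha hb hab => ?_⟩
  have hw : a • y + b • z ∈ s := hs hy hz ha hb hab
  simp only [smul_eq_mul]
  set A := ∫ x, Real.exp (φ y x) ∂μ with hA
  set B := ∫ x, Real.exp (φ z x) ∂μ with hB
  have hA0 : 0 < A := hpos y hy
  have hB0 : 0 < B := hpos z hz
  rw [Real.log_le_iff_le_exp (hpos _ hw)]
  set K := Real.exp (a * Real.log A + b * Real.log B) with hK
  have hbound : ∀ x, Real.exp (φ (a • y + b • z) x) ≤
      K * (a * (Real.exp (φ y x) / A) + b * (Real.exp (φ z x) / B)) := by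
    intro x
    have hconv := (hφ x).2 hy hz ha hb hab
    have hexp := convexOn_exp.2 (Set.mem_univ (φ y x - Real.log A))
      (Set.mem_univ (φ z x - Real.log B)) ha hb hab
    simp only [smul_eq_mul, Real.exp_sub, Real.exp_log hA0, Real.exp_log hB0] at hconv hexp
    calc Real.exp (φ (a • y + b • z) x)
        ≤ Real.exp (a * φ y x + b * φ z x) := Real.exp_le_exp.2 hconv
      _ = K * Real.exp (a * (φ y x - Real.log A) + b * (φ z x - Real.log B)) := by
          rw [hK, ← Real.exp_add]; ring_nf
      _ ≤ _ := mul_le_mul_of_nonneg_left hexp (Real.exp_pos _).le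
  have hiy : Integrable (fun x => a * (Real.exp (φ y x) / A)) μ :=
    ((hint y hy).div_const A).const_mul a
  have hiz : Integrable (fun x => b * (Real.exp (φ z x) / B)) μ :=
    ((hint z hz).div_const B).const_mul b
  calc ∫ x, Real.exp (φ (a • y + b • z) x) ∂μ
      ≤ ∫ x, K * (a * (Real.exp (φ y x) / A) + b * (Real.exp (φ z x) / B)) ∂μ :=
        integral_mono (hint _ hw) ((hiy.add hiz).const_mul K) hbound
    _ = K := by
        rw [integral_const_mul, integral_add hiy hiz, integral_const_mul, integral_const_mul,
          integral_div, integral_div, ← hA, ← hB, div_self hA0.ne', div_self hB0.ne', mul_one,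
          mul_one, hab, mul_one]

/-- The difference of the squared distances to two points is affine, hence convex. -/
theorem convexOn_sq_dist_sub_sq_dist {E : Type*} [NormedAddCommGroup E] [InnerProductSpace ℝ E]
    (x x' : E) : ConvexOn ℝ Set.univ (fun y : E => ‖x - y‖ ^ 2 - ‖y - x'‖ ^ 2) := by
  refine ⟨convex_univ, fun y _ z _ a b _ _ hab => le_of_eq ?_⟩
  obtain rfl : b = 1 - a := by linarith
  simp only [norm_sub_sq_real, inner_add_left, inner_add_right, real_inner_smul_left,
    real_inner_smul_right, smul_eq_mul]
  ring

/-- Lemma 11: if `W` is `c`-strongly convex and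
`g(y) = -ε log ∫ exp((h(x) - ‖y-x‖²/2)/ε) dμ(x)`, then for every `x` the function
`y ↦ W(y) + (1/ε)(‖x-y‖²/2 - g(y))` is `c`-strongly convex. -/
theorem stronglyConvex_conditional_potential
    (d : ℕ) (μ : Measure (EuclideanSpace ℝ (Fin d))) [IsProbabilityMeasure μ]
    (ε : ℝ) (hε : 0 < ε)
    (h : EuclideanSpace ℝ (Fin d) → ℝ) (hmeas : Measurable h)
    (hint : ∀ y : EuclideanSpace ℝ (Fin d),
      Integrable (fun x => Real.exp ((h x - ‖y - x‖ ^ 2 / 2) / ε)) μ)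
    (hpos : ∀ y : EuclideanSpace ℝ (Fin d),
      0 < ∫ x, Real.exp ((h x - ‖y - x‖ ^ 2 / 2) / ε) ∂μ)
    (g : EuclideanSpace ℝ (Fin d) → ℝ)
    (hg : ∀ y, g y = -ε * Real.log (∫ x, Real.exp ((h x - ‖y - x‖ ^ 2 / 2) / ε) ∂μ))
    (c : ℝ) (hc : 0 < c)
    (W : EuclideanSpace ℝ (Fin d) → ℝ)
    (hW : ConvexOn ℝ Set.univ (fun y => W y - (c / 2) * ‖y‖ ^ 2)) :
    ∀ x : EuclideanSpace ℝ (Fin d),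
      ConvexOn ℝ Set.univ (fun y : EuclideanSpace ℝ (Fin d) =>
        (W y + (1 / ε) * (‖x - y‖ ^ 2 / 2 - g y)) - (c / 2) * ‖y‖ ^ 2) := by
  intro x
  have hexp : ∀ y x', Real.exp ((h x' + (‖x - y‖ ^ 2 - ‖y - x'‖ ^ 2) / 2) / ε) =
      Real.exp (‖x - y‖ ^ 2 / 2 / ε) * Real.exp ((h x' - ‖y - x'‖ ^ 2 / 2) / ε) := by
    intro y x'
    rw [← Real.exp_add]
    ring_nf
  have hconv : ConvexOn ℝ Set.univ (fun y => Real.log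
      (∫ x', Real.exp ((h x' + (‖x - y‖ ^ 2 - ‖y - x'‖ ^ 2) / 2) / ε) ∂μ)) := by
    refine convexOn_log_integral_exp convex_univ (fun x' => ?_) (fun y _ => ?_) (fun y _ => ?_)
    · refine (((convexOn_sq_dist_sub_sq_dist x x').smul
        (by positivity : 0 ≤ 1 / (2 * ε))).add_const (h x' / ε)).congr fun y _ => ?_
      simp only [Pi.add_apply, smul_eq_mul]
      field_simp
      ring
    · simp only [hexp]
      exact (hint y).const_mul _
    · simp only [hexp, integral_const_mul]
      exact mul_pos (Real.exp_pos _) (hpos y)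
  refine (hW.add hconv).congr fun y _ => ?_
  simp only [Pi.add_apply, hexp, integral_const_mul]
  rw [Real.log_mul (Real.exp_pos _).ne' (hpos y).ne', Real.log_exp, hg y]
  field_simp
  ring
end

section
/- Let S and T be standard Borel spaces and let α and β be probability measures on S × T whose first marginals (pushforwards under (x,y) ↦ x) are equal, say both equal to μ. Then KL(α ‖ β) = ∫ KL(α(·|x) ‖ β(·|x)) dμ(x), where α(·|x) and β(·|x) denote the conditional (disintegration) kernels of α and β over their first marginal, and both sides take values in [0, ∞]. (First equality in Proposition 5: the KL divergence between two joint measures with a common first marginal equals the averaged KL divergence between their conditionals.) -/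
open MeasureTheory
open scoped ENNReal Classical

/-- The Kullback–Leibler divergence `KL(π ‖ ρ) = ∫ log(dπ/dρ) dπ ∈ [0, ∞]`, equal to `∞`
if `π` is not absolutely continuous with respect to `ρ` (or if the log-likelihood ratio
fails to be integrable, in which case the integral is `+∞`). -/
noncomputable def klDiv' {X : Type*} [MeasurableSpace X] (π ρ : Measure X) : ℝ≥0∞ :=
  if π ≪ ρ ∧ Integrable (fun x => Real.log (π.rnDeriv ρ x).toReal) π then
    ENNReal.ofReal (∫ x, Real.log (π.rnDeriv ρ x).toReal ∂π)
  else ⊤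

open InformationTheory ProbabilityTheory

theorem klDiv'_eq_klDiv {X : Type*} [MeasurableSpace X] (π ρ : Measure X)
    [IsProbabilityMeasure π] [IsProbabilityMeasure ρ] : klDiv' π ρ = klDiv π ρ := by
  simp [klDiv', klDiv_def, llr_def]

/-- The Radon–Nikodym derivative of `μ ⊗ₘ κ` with respect to `μ ⊗ₘ η` is given fibrewise by the
kernel derivative of `κ` with respect to `η`. -/
theorem rnDeriv_compProd_right {S T : Type*} [MeasurableSpace S] [MeasurableSpace T]
    [MeasurableSpace.CountableOrCountablyGenerated S T]
    {μ : Measure S} [IsFiniteMeasure μ] {κ η : Kernel S T} [IsFiniteKernel κ] [IsFiniteKernel η]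
    (h : ∀ᵐ x ∂μ, κ x ≪ η x) :
    (μ ⊗ₘ κ).rnDeriv (μ ⊗ₘ η) =ᵐ[μ ⊗ₘ η] fun p ↦ κ.rnDeriv η p.1 p.2 := by
  have h_eq : μ ⊗ₘ κ = (μ ⊗ₘ η).withDensity fun p ↦ κ.rnDeriv η p.1 p.2 := by
    rw [← Measure.compProd_withDensity (Kernel.measurable_rnDeriv κ η)]
    refine Measure.compProd_congr ?_
    filter_upwards [h] with x hx using (Kernel.withDensity_rnDeriv_eq hx).symm
  rw [h_eq]
  exact Measure.rnDeriv_withDensity _ (Kernel.measurable_rnDeriv κ η)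

/-- Averaging the divergence between two kernels over a measure gives the divergence between
the composition products. -/
theorem klDiv_compProd_right {S T : Type*} [MeasurableSpace S] [MeasurableSpace T]
    [MeasurableSpace.CountableOrCountablyGenerated S T]
    (μ : Measure S) [IsFiniteMeasure μ] (κ η : Kernel S T) [IsFiniteKernel κ] [IsFiniteKernel η] :
    klDiv (μ ⊗ₘ κ) (μ ⊗ₘ η) = ∫⁻ x, klDiv (κ x) (η x) ∂μ := by
  by_cases h : ∀ᵐ x ∂μ, κ x ≪ η x
  · have h_meas : Measurable fun p : S × T ↦
        ENNReal.ofReal (klFun (κ.rnDeriv η p.1 p.2).toReal) :=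
      (measurable_klFun.comp (Kernel.measurable_rnDeriv κ η).ennreal_toReal).ennreal_ofReal
    rw [klDiv_eq_lintegral_klFun_of_ac (Measure.absolutelyContinuous_compProd_right_iff.mpr h)]
    calc ∫⁻ p, ENNReal.ofReal (klFun ((μ ⊗ₘ κ).rnDeriv (μ ⊗ₘ η) p).toReal) ∂(μ ⊗ₘ η)
      _ = ∫⁻ p, ENNReal.ofReal (klFun (κ.rnDeriv η p.1 p.2).toReal) ∂(μ ⊗ₘ η) := by
        refine lintegral_congr_ae ?_
        filter_upwards [rnDeriv_compProd_right h] with p hp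
        rw [hp]
      _ = ∫⁻ x, ∫⁻ y, ENNReal.ofReal (klFun (κ.rnDeriv η x y).toReal) ∂(η x) ∂μ :=
        Measure.lintegral_compProd h_meas
      _ = ∫⁻ x, klDiv (κ x) (η x) ∂μ := by
        refine lintegral_congr_ae ?_
        filter_upwards [h] with x hx
        rw [klDiv_eq_lintegral_klFun_of_ac hx]
        refine lintegral_congr_ae ?_
        filter_upwards [Kernel.rnDeriv_eq_rnDeriv_measure (κ := κ) (η := η) (a := x)] with y hy
        rw [hy]
  · rw [klDiv_of_not_ac (mt Measure.absolutelyContinuous_compProd_right_iff.mp h), eq_comm,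
      eq_top_iff]
    have h_meas : MeasurableSet {x | ¬ κ x ≪ η x} :=
      (Kernel.measurableSet_absolutelyContinuous κ η).compl
    calc ⊤ = ∫⁻ _ in {x | ¬ κ x ≪ η x}, ⊤ ∂μ := by
          rw [setLIntegral_const, ENNReal.top_mul (mt ae_iff.mpr h)]
      _ = ∫⁻ x in {x | ¬ κ x ≪ η x}, klDiv (κ x) (η x) ∂μ :=
          setLIntegral_congr_fun h_meas fun _ hx ↦ (klDiv_of_not_ac hx).symm
      _ ≤ ∫⁻ x, klDiv (κ x) (η x) ∂μ := setLIntegral_le_lintegral _ _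

/-- First equality in Proposition 5 (chain rule): for probability measures `α, β` on a
product of standard Borel spaces with the same first marginal `μ`,
`KL(α ‖ β) = ∫ KL(α(·|x) ‖ β(·|x)) dμ(x)`. -/
theorem klDiv_eq_integral_klDiv_condKernel
    {S T : Type*} [MeasurableSpace S] [StandardBorelSpace S]
    [MeasurableSpace T] [StandardBorelSpace T] [Nonempty T]
    (α β : Measure (S × T)) [IsProbabilityMeasure α] [IsProbabilityMeasure β]
    (μ : Measure S) (hα : α.fst = μ) (hβ : β.fst = μ) :
    klDiv' α β = ∫⁻ x, klDiv' (α.condKernel x) (β.condKernel x) ∂μ := by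
  have : IsProbabilityMeasure μ := hα ▸ inferInstance
  have hα' : μ ⊗ₘ α.condKernel = α := hα ▸ α.disintegrate α.condKernel
  have hβ' : μ ⊗ₘ β.condKernel = β := hβ ▸ β.disintegrate β.condKernel
  simp_rw [klDiv'_eq_klDiv]
  rw [← klDiv_compProd_right, hα', hβ']
end

section
/- Let c > 0 and let ν be a probability measure on ℝᵈ with density e^{−W} with respect to Lebesgue measure, where W : ℝᵈ → ℝ is twice continuously differentiable and its Hessian satisfies ⟨v, ∇²W(y)v⟩ ≥ c‖v‖² for all y, v ∈ ℝᵈ. Let Y ∼ ν and let m = E[Y] be its mean. Then E[‖Y − m‖²] = Tr Cov(Y) ≤ d/c. (Covariance-trace bound derived via the Brascamp–Lieb inequality in the proof of Theorem 12.) -/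
open MeasureTheory

section Convexity

variable {E : Type*} [NormedAddCommGroup E] [InnerProductSpace ℝ E]

/-- The second-order lower bound along a ray coming from a uniform lower bound on the Hessian. -/
lemma monotoneOn_ray_of_hessian_bound {c : ℝ} {W : E → ℝ} (hW : ContDiff ℝ 2 W)
    (hHess : ∀ y v : E, c * ‖v‖ ^ 2 ≤ iteratedFDeriv ℝ 2 W y ![v, v]) (a v : E) :
    MonotoneOn (fun s : ℝ => W (a + s • v) - c / 2 * s ^ 2 * ‖v‖ ^ 2 - s * fderiv ℝ W a v)
      (Set.Ici 0) := by
  have hline : ∀ s : ℝ, HasDerivAt (fun s : ℝ => a + s • v) v s := fun s => by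
    simpa using ((hasDerivAt_id s).smul_const v).const_add a
  have hW1 : Differentiable ℝ W := hW.differentiable (by norm_num)
  have hW2 : Differentiable ℝ (fderiv ℝ W) :=
    (hW.fderiv_right (m := 1) (by norm_num)).differentiable (by norm_num)
  have hφ : ∀ s : ℝ, HasDerivAt (fun s : ℝ => W (a + s • v)) (fderiv ℝ W (a + s • v) v) s :=
    fun s => (hW1 _).hasFDerivAt.comp_hasDerivAt s (hline s)
  have hφ' : ∀ s : ℝ, HasDerivAt (fun s : ℝ => fderiv ℝ W (a + s • v) v)
      (iteratedFDeriv ℝ 2 W (a + s • v) ![v, v]) s := fun s => by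
    rw [iteratedFDeriv_two_apply]
    simpa using ((hW2 _).hasFDerivAt.comp_hasDerivAt s (hline s)).clm_apply (hasDerivAt_const s v)
  have hmono : Monotone fun s : ℝ => fderiv ℝ W (a + s • v) v - s * (c * ‖v‖ ^ 2) := by
    have hd : ∀ s : ℝ, HasDerivAt (fun s : ℝ => fderiv ℝ W (a + s • v) v - s * (c * ‖v‖ ^ 2))
        (iteratedFDeriv ℝ 2 W (a + s • v) ![v, v] - 1 * (c * ‖v‖ ^ 2)) s :=
      fun s => (hφ' s).sub ((hasDerivAt_id s).mul_const _)
    refine monotone_of_deriv_nonneg (fun s => (hd s).differentiableAt) fun s => ?_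
    rw [(hd s).deriv]
    linarith [hHess (a + s • v) v]
  have hd : ∀ s : ℝ, HasDerivAt
      (fun s : ℝ => W (a + s • v) - c / 2 * s ^ 2 * ‖v‖ ^ 2 - s * fderiv ℝ W a v)
      (fderiv ℝ W (a + s • v) v - s * (c * ‖v‖ ^ 2) - fderiv ℝ W a v) s := fun s => by
    refine (((hφ s).sub ((((hasDerivAt_id s).pow 2).const_mul (c / 2)).mul_const
      (‖v‖ ^ 2))).sub ((hasDerivAt_id s).mul_const (fderiv ℝ W a v))).congr_deriv ?_
    simp
    ring
  refine monotoneOn_of_deriv_nonneg (convex_Ici 0)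
    (fun s _ => (hd s).continuousAt.continuousWithinAt)
    (fun s _ => (hd s).differentiableAt.differentiableWithinAt) fun s hs => ?_
  rw [(hd s).deriv]
  have h := hmono (interior_subset hs : (0 : ℝ) ≤ s)
  simp only [zero_smul, add_zero, zero_mul, sub_zero] at h
  linarith

lemma exists_forall_le_of_hessian_bound [FiniteDimensional ℝ E] {c : ℝ} (hc : 0 < c) {W : E → ℝ}
    (hW : ContDiff ℝ 2 W)
    (hHess : ∀ y v : E, c * ‖v‖ ^ 2 ≤ iteratedFDeriv ℝ 2 W y ![v, v]) :
    ∃ a, ∀ y, W a ≤ W y := by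
  have hlow : ∀ y, W 0 + ‖y‖ * (c / 2 * ‖y‖ - ‖fderiv ℝ W 0‖) ≤ W y := fun y => by
    have h := monotoneOn_ray_of_hessian_bound hW hHess 0 y (by simp) (by simp) zero_le_one
    simp only [zero_smul, one_smul, zero_add] at h
    have h' := neg_le_of_abs_le ((fderiv ℝ W 0).le_opNorm y)
    nlinarith
  refine hW.continuous.exists_forall_le (Filter.tendsto_atTop_mono hlow ?_)
  refine Filter.tendsto_atTop_add_const_left _ _ ?_
  have hn := tendsto_norm_cocompact_atTop (E := E)
  refine hn.atTop_mul_atTop₀ ?_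
  simpa [sub_eq_add_neg] using
    Filter.tendsto_atTop_add_const_right _ (-‖fderiv ℝ W 0‖) (hn.const_mul_atTop (half_pos hc))

/-- Comparison of a potential with its dilations about a minimizer. -/
lemma dilation_le_of_hessian_bound {c : ℝ} {W : E → ℝ} (hW : ContDiff ℝ 2 W)
    (hHess : ∀ y v : E, c * ‖v‖ ^ 2 ≤ iteratedFDeriv ℝ 2 W y ![v, v]) {a : E}
    (ha : ∀ y, W a ≤ W y) {t : ℝ} (ht0 : 0 ≤ t) (ht1 : t ≤ 1) (v : E) :
    W (a + t • v) + c / 2 * (1 - t ^ 2) * ‖v‖ ^ 2 ≤ W (a + v) := by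
  have hmin : IsLocalMin W a := Filter.Eventually.of_forall ha
  have h := monotoneOn_ray_of_hessian_bound hW hHess a v ht0 (Set.mem_Ici.2 zero_le_one) ht1
  simp only [one_smul, hmin.fderiv_eq_zero, zero_apply] at h
  linarith

end Convexity

lemma tendsto_inv_pow_sub_one_div (d : ℕ) :
    Filter.Tendsto (fun t : ℝ => ((t ^ d)⁻¹ - 1) / (1 - t ^ 2)) (nhdsWithin 1 (Set.Iio 1))
      (nhds ((d : ℝ) / 2)) := by
  have hcont : ContinuousAt
      (fun t : ℝ => (∑ i ∈ Finset.range d, t ^ i) / (t ^ d * (1 + t))) 1 := by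
    refine ContinuousAt.div (by fun_prop) (by fun_prop) (by norm_num)
  have h := hcont.tendsto.mono_left (nhdsWithin_le_nhds (s := Set.Iio (1 : ℝ)))
  simp only [one_pow, Finset.sum_const, Finset.card_range, nsmul_eq_mul, mul_one, one_mul] at h
  norm_num at h
  refine h.congr' ?_
  filter_upwards [Ioo_mem_nhdsLT (zero_lt_one (α := ℝ))] with t ht
  have ht0 : t ≠ 0 := ht.1.ne'
  have h1 : 1 - t ≠ 0 := by linarith [ht.2]
  have h2 : 1 + t ≠ 0 := by linarith [ht.1]
  have h3 : 1 - t ^ 2 ≠ 0 := by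
    rw [show 1 - t ^ 2 = (1 - t) * (1 + t) by ring]; exact mul_ne_zero h1 h2
  have hg := mul_neg_geom_sum t d
  field_simp
  rw [← hg]
  ring

section SecondMoment

variable {E : Type*} [NormedAddCommGroup E] [InnerProductSpace ℝ E] [FiniteDimensional ℝ E]
  [MeasurableSpace E] [BorelSpace E]

/-- The second moment of a normalized density that dominates, under dilations, its own Gaussian
tilts. -/
lemma second_moment_le_of_dilation {c : ℝ} (hc : 0 < c) {f : E → ℝ} (hf : Integrable f)
    (hf0 : ∀ y, 0 ≤ f y) (hf1 : ∫ y, f y = 1)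
    (hdil : ∀ t : ℝ, 0 ≤ t → t ≤ 1 → ∀ y,
      f y * (1 + c / 2 * (1 - t ^ 2) * ‖y‖ ^ 2) ≤ f (t • y)) :
    Integrable (fun y => f y * ‖y‖ ^ 2) ∧
      ∫ y, f y * ‖y‖ ^ 2 ≤ Module.finrank ℝ E / c := by
  have hint : Integrable (fun y => f y * ‖y‖ ^ 2) := by
    have h2 : (2⁻¹ : ℝ) ≠ 0 := by norm_num
    refine ((hf.comp_smul h2).const_mul (8 / (3 * c))).mono'
      (hf.aestronglyMeasurable.mul (by fun_prop)) (Filter.Eventually.of_forall fun y => ?_)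
    rw [Real.norm_of_nonneg (mul_nonneg (hf0 y) (by positivity))]
    have h := hdil 2⁻¹ (by norm_num) (by norm_num) y
    rw [div_mul_eq_mul_div, le_div_iff₀ (by positivity)]
    have := hf0 y
    nlinarith
  refine ⟨hint, ?_⟩
  have hbound : ∀ t ∈ Set.Ioo (0 : ℝ) 1,
      ∫ y, f y * ‖y‖ ^ 2 ≤ 2 / c * (((t ^ Module.finrank ℝ E)⁻¹ - 1) / (1 - t ^ 2)) := by
    intro t ht
    have hpos : 0 < 1 - t ^ 2 := by nlinarith [ht.1, ht.2]
    have hle : ∫ y, (f y + c / 2 * (1 - t ^ 2) * (f y * ‖y‖ ^ 2)) ≤ ∫ y, f (t • y) :=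
      integral_mono (hf.add (hint.const_mul _)) (hf.comp_smul ht.1.ne') fun y => by
        have := hdil t ht.1.le ht.2.le y
        simp only
        linarith
    rw [integral_add hf (hint.const_mul _), integral_const_mul, hf1, Measure.integral_comp_smul,
      hf1, abs_of_nonneg (inv_nonneg.2 (pow_nonneg ht.1.le _)), smul_eq_mul, mul_one] at hle
    rw [div_mul_div_comm, le_div_iff₀ (by positivity)]
    linarith
  have hlim := (tendsto_inv_pow_sub_one_div (Module.finrank ℝ E)).const_mul (2 / c)
  rw [show 2 / c * ((Module.finrank ℝ E : ℝ) / 2) = Module.finrank ℝ E / c by field_simp] at hlim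
  refine ge_of_tendsto hlim ?_
  filter_upwards [Ioo_mem_nhdsLT (zero_lt_one (α := ℝ))] with t ht using hbound t ht

end SecondMoment

/-- The mean minimizes the expected squared distance. -/
lemma integral_norm_sub_mean_sq_le {E : Type*} [NormedAddCommGroup E] [InnerProductSpace ℝ E]
    [CompleteSpace E] [MeasurableSpace E] {ν : Measure E} [IsProbabilityMeasure ν] (a : E)
    (hid : Integrable (fun y => y) ν) (ha : Integrable (fun y => ‖y - a‖ ^ 2) ν) :
    Integrable (fun y => ‖y - ∫ y', y' ∂ν‖ ^ 2) ν ∧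
      ∫ y, ‖y - ∫ y', y' ∂ν‖ ^ 2 ∂ν ≤ ∫ y, ‖y - a‖ ^ 2 ∂ν := by
  set m := ∫ y', y' ∂ν with hm
  have hsub : Integrable (fun y => y - a) ν := hid.sub (integrable_const a)
  have hinner : Integrable (fun y => 2 * inner ℝ (m - a) (y - a)) ν :=
    (hsub.const_inner (m - a)).const_mul 2
  have heq : ∀ y, ‖y - m‖ ^ 2 = ‖y - a‖ ^ 2 - 2 * inner ℝ (m - a) (y - a) + ‖m - a‖ ^ 2 := by
    intro y
    rw [← sub_sub_sub_cancel_right y m a, norm_sub_sq_real, real_inner_comm]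
  have hi : Integrable (fun y => ‖y - a‖ ^ 2 - 2 * inner ℝ (m - a) (y - a)) ν := ha.sub hinner
  simp_rw [heq]
  refine ⟨hi.add (integrable_const _), ?_⟩
  rw [integral_add hi (integrable_const _), integral_sub ha hinner, integral_const_mul,
    integral_inner hsub, integral_sub hid (integrable_const a), ← hm]
  simp only [integral_const, probReal_univ, one_smul, real_inner_self_eq_norm_sq]
  nlinarith [sq_nonneg ‖m - a‖]

/-- Covariance-trace bound via the Brascamp–Lieb inequality: if `ν` has density `e^{-W}`
with `W` twice continuously differentiable and `∇²W ⪰ c·Id`, then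
`E ‖Y - E Y‖² = Tr Cov(Y) = ∑ᵢ E (Yᵢ - E Yᵢ)² ≤ d / c`. -/
theorem trace_cov_le_of_strong_hessian_bound
    (d : ℕ) (c : ℝ) (hc : 0 < c)
    (W : EuclideanSpace ℝ (Fin d) → ℝ) (hW : ContDiff ℝ 2 W)
    (hHess : ∀ (y v : EuclideanSpace ℝ (Fin d)),
      c * ‖v‖ ^ 2 ≤ iteratedFDeriv ℝ 2 W y ![v, v])
    (ν : Measure (EuclideanSpace ℝ (Fin d))) [IsProbabilityMeasure ν]
    (hν : ν = volume.withDensity fun y => ENNReal.ofReal (Real.exp (-W y))) :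
    (∫ y, ‖y - ∫ y', y' ∂ν‖ ^ 2 ∂ν
        = ∑ i : Fin d, ∫ y, (y i - (∫ y', y' ∂ν) i) ^ 2 ∂ν) ∧
      ∫ y, ‖y - ∫ y', y' ∂ν‖ ^ 2 ∂ν ≤ d / c := by
  obtain ⟨a, ha⟩ := exists_forall_le_of_hessian_bound hc hW hHess
  have hcW : Continuous W := hW.continuous
  have hmeas : Measurable fun y => ENNReal.ofReal (Real.exp (-W y)) :=
    (ENNReal.continuous_ofReal.comp (by fun_prop)).measurable
  have hfin : ∀ᵐ y : EuclideanSpace ℝ (Fin d), ENNReal.ofReal (Real.exp (-W y)) < ⊤ :=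
    Filter.Eventually.of_forall fun _ => ENNReal.ofReal_lt_top
  have htoReal : ∀ y, (ENNReal.ofReal (Real.exp (-W y))).toReal = Real.exp (-W y) :=
    fun y => ENNReal.toReal_ofReal (Real.exp_pos _).le
  have hintegrable : ∀ g : EuclideanSpace ℝ (Fin d) → ℝ,
      Integrable g ν ↔ Integrable fun y => Real.exp (-W y) * g y := fun g => by
    rw [hν, integrable_withDensity_iff_integrable_smul' hmeas hfin]
    simp only [htoReal, smul_eq_mul]
  have hintegral : ∀ g : EuclideanSpace ℝ (Fin d) → ℝ,
      ∫ y, g y ∂ν = ∫ y, Real.exp (-W y) * g y := fun g => by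
    rw [hν, integral_withDensity_eq_integral_toReal_smul hmeas hfin]
    simp only [htoReal, smul_eq_mul]
  have hexp : Integrable fun y => Real.exp (-W y) := by
    simpa using (hintegrable fun _ => 1).1 (integrable_const 1)
  have hexp1 : ∫ y, Real.exp (-W y) = 1 := by
    simpa using (hintegral fun _ => 1).symm
  obtain ⟨hmom, hmom_le⟩ := second_moment_le_of_dilation hc
    (f := fun y => Real.exp (-W (a + y))) (hexp.comp_add_left a) (fun y => (Real.exp_pos _).le)
    (by rw [integral_add_left_eq_self (fun y => Real.exp (-W y)) a, hexp1])
    (fun t ht0 ht1 y => by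
      have h := dilation_le_of_hessian_bound hW hHess ha ht0 ht1 y
      calc Real.exp (-W (a + y)) * (1 + c / 2 * (1 - t ^ 2) * ‖y‖ ^ 2)
          ≤ Real.exp (-W (a + y)) * Real.exp (c / 2 * (1 - t ^ 2) * ‖y‖ ^ 2) := by
            gcongr
            linarith [Real.add_one_le_exp (c / 2 * (1 - t ^ 2) * ‖y‖ ^ 2)]
        _ ≤ Real.exp (-W (a + t • y)) := by
            rw [← Real.exp_add]
            exact Real.exp_le_exp.2 (by linarith))
  have hshift : ∀ y, Real.exp (-W (a + y)) * ‖y‖ ^ 2 =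
      (fun z => Real.exp (-W z) * ‖z - a‖ ^ 2) (a + y) := fun y => by simp
  have hsq : Integrable (fun y => ‖y - a‖ ^ 2) ν := by
    rw [hintegrable]
    simpa [neg_add_eq_sub] using hmom.comp_add_left (-a)
  have hsq_le : ∫ y, ‖y - a‖ ^ 2 ∂ν ≤ d / c := by
    simp_rw [hshift] at hmom_le
    rw [integral_add_left_eq_self (fun z => Real.exp (-W z) * ‖z - a‖ ^ 2) a] at hmom_le
    rw [hintegral]
    simpa using hmom_le
  have hid : Integrable (fun y : EuclideanSpace ℝ (Fin d) => y) ν := by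
    have h : MemLp (fun y => y - a) 2 ν :=
      (memLp_two_iff_integrable_sq_norm (by fun_prop)).2 hsq
    have h' := (h.integrable (by norm_num)).add (integrable_const a)
    exact h'.congr (Filter.Eventually.of_forall fun y => sub_add_cancel y a)
  obtain ⟨hvar, hvar_le⟩ := integral_norm_sub_mean_sq_le a hid hsq
  refine ⟨?_, hvar_le.trans hsq_le⟩
  simp_rw [EuclideanSpace.real_norm_sq_eq, PiLp.sub_apply] at hvar ⊢
  refine integral_finsetSum _ fun i _ => hvar.mono' (by fun_prop)
    (Filter.Eventually.of_forall fun y => ?_)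
  rw [Real.norm_of_nonneg (sq_nonneg _)]
  exact Finset.single_le_sum (f := fun j => (y j - (∫ y', y' ∂ν) j) ^ 2)
    (fun j _ => sq_nonneg _) (Finset.mem_univ i)
end
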